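/- arXiv:1707.03068 — 3 statements merged into one kernel-verified Lean document; each statement's English description precedes it below -/
import Mathlib

section
/- Let d ≥ 1, let D ⊆ ℝ^d be Lebesgue measurable with convex hull of finite Lebesgue measure, let f : D → ℝ be bounded, let r > 0 and 0 < α ≤ 1. Then for every δ > 0 the outer Lebesgue integral over D satisfies ∫*_D osc_δ(osc_r f) dLeb ≤ 2·(sup_D f − inf_D f)·Leb(convexHull D)·((2d+1)/r)^α·δ^α. Equivalently, the generalized α-Hölder seminorm (with respect to Lebesgue measure on D) of osc_r f is at most 2·(sup_D f − inf_D f)·Leb(convexHull D)·((2d+1)/r)^α. -/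
open MeasureTheory

/-- The `ρ`-oscillation of `f` at `x`, with all points restricted to a
domain `D`: the supremum minus the infimum of `f` over the intersection of
`D` with the closed ball of radius `ρ` centred at `x`. -/
noncomputable def oscOn {E : Type*} [MetricSpace E]
    (D : Set E) (f : E → ℝ) (ρ : ℝ) (x : E) : ℝ :=
  sSup (f '' (D ∩ Metric.closedBall x ρ)) - sInf (f '' (D ∩ Metric.closedBall x ρ))

section Expansion

variable {E : Type*} [NormedAddCommGroup E]

/-- An antilipschitz self-map contracts Haar measure by at most the expected factor. -/
theorem AntilipschitzWith.le_addHaar_image [NormedSpace ℝ E] [FiniteDimensional ℝ E]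
    [MeasurableSpace E] [BorelSpace E]
    (μ : Measure E) [μ.IsAddHaarMeasure] {K : NNReal} {T : E → E}
    (hT : AntilipschitzWith K T) (s : Set E) :
    μ s ≤ (K : ENNReal) ^ Module.finrank ℝ E * μ (T '' s) := by
  rw [Measure.isAddLeftInvariant_eq_smul μ (Measure.hausdorffMeasure (Module.finrank ℝ E : ℝ))]
  have h := hT.le_hausdorffMeasure_image (d := Module.finrank ℝ E) (Nat.cast_nonneg _) s
  rw [ENNReal.rpow_natCast] at h
  simp only [Measure.smul_apply, ENNReal.smul_def, smul_eq_mul]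
  calc _ ≤ _ := mul_le_mul_right h _
    _ = _ := by ring

variable [InnerProductSpace ℝ E]

/-- Moving every point towards a nearest point of a set expands distances by at least the
remaining fraction. -/
theorem antilipschitzWith_lineMap_of_nearest {p : E → E}
    (hp : ∀ x y, dist x (p x) ≤ dist x (p y)) {l : ℝ} (hl : 0 < l) (hl1 : l ≤ 1) :
    AntilipschitzWith (Real.toNNReal l⁻¹) (fun x => p x + l • (x - p x)) := by
  refine AntilipschitzWith.of_le_mul_dist fun x y => ?_
  rw [Real.coe_toNNReal _ (inv_nonneg.2 hl.le), inv_mul_eq_div, le_div_iff₀ hl]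
  have hmono : 0 ≤ inner ℝ (p x - p y) (x - y) := by
    have h1 : ‖x - p x‖ ^ 2 ≤ ‖x - p y‖ ^ 2 := by
      have := hp x y
      rw [dist_eq_norm, dist_eq_norm] at this
      gcongr
    have h2 : ‖y - p y‖ ^ 2 ≤ ‖y - p x‖ ^ 2 := by
      have := hp y x
      rw [dist_eq_norm, dist_eq_norm] at this
      gcongr
    simp only [norm_sub_sq_real] at h1 h2
    simp only [inner_sub_left, inner_sub_right]
    rw [real_inner_comm x (p x), real_inner_comm y (p x), real_inner_comm x (p y),
      real_inner_comm y (p y)]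
    linarith
  have hkey : l * ‖x - y‖ ^ 2 ≤
      inner ℝ ((p x + l • (x - p x)) - (p y + l • (y - p y))) (x - y) := by
    have : (p x + l • (x - p x)) - (p y + l • (y - p y))
        = l • (x - y) + (1 - l) • (p x - p y) := by module
    rw [this, inner_add_left, inner_smul_left, inner_smul_left, real_inner_self_eq_norm_sq]
    simp only [conj_trivial]
    nlinarith [mul_nonneg (sub_nonneg.2 hl1) hmono]
  have hcs := hkey.trans (real_inner_le_norm _ _)
  rw [dist_eq_norm, dist_eq_norm]
  rcases (norm_nonneg (x - y)).eq_or_lt with h0 | h0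
  · rw [← h0]; simp
  · refine le_of_mul_le_mul_right ?_ h0
    nlinarith

variable [FiniteDimensional ℝ E] [MeasurableSpace E] [BorelSpace E]

/-- Inside a convex set, the measure of the `s`-neighbourhood of a subset grows at most like the
measure of a ball of radius `s`. -/
theorem Convex.pow_mul_addHaar_infDist_le (μ : Measure E) [μ.IsAddHaarMeasure] {K A : Set E}
    (hK : Convex ℝ K) (hA : IsClosed A) (hne : A.Nonempty) (hAK : A ⊆ K)
    {l s : ℝ} (hl : 0 < l) (hl1 : l ≤ 1) :
    ENNReal.ofReal (l ^ Module.finrank ℝ E) * μ (K ∩ {x | Metric.infDist x A ≤ s}) ≤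
      μ (K ∩ {x | Metric.infDist x A ≤ l * s}) := by
  choose p hpA hp using fun x => hA.exists_infDist_eq_dist hne x
  have hT := antilipschitzWith_lineMap_of_nearest (p := p)
    (fun x y => by rw [← hp x]; exact Metric.infDist_le_dist_of_mem (hpA y)) hl hl1
  have himage : (fun x => p x + l • (x - p x)) '' (K ∩ {x | Metric.infDist x A ≤ s}) ⊆
      K ∩ {x | Metric.infDist x A ≤ l * s} := by
    rintro _ ⟨x, ⟨hxK, hxs⟩, rfl⟩
    refine ⟨hK.add_smul_sub_mem (hAK (hpA x)) hxK ⟨hl.le, hl1⟩, ?_⟩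
    refine (Metric.infDist_le_dist_of_mem (hpA x)).trans ?_
    rw [Set.mem_ofPred_eq, hp x, dist_eq_norm] at hxs
    rw [dist_eq_norm, add_sub_cancel_left, norm_smul, Real.norm_of_nonneg hl.le]
    gcongr
  have h := (hT.le_addHaar_image μ (K ∩ {x | Metric.infDist x A ≤ s})).trans
    (mul_le_mul_right (measure_mono himage) _)
  calc _ ≤ ENNReal.ofReal (l ^ Module.finrank ℝ E) * _ := mul_le_mul_right h _
    _ = _ := by
      rw [← mul_assoc, ENNReal.ofReal_pow hl.le]
      change _ ^ _ * ENNReal.ofReal l⁻¹ ^ _ * _ = _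
      rw [← mul_pow, ← ENNReal.ofReal_mul hl.le, mul_inv_cancel₀ hl.ne']
      simp

/-- Measure of a distance shell around a subset of a convex set. -/
theorem Convex.addHaar_shell_le (μ : Measure E) [μ.IsAddHaarMeasure] {K A : Set E}
    (hK : Convex ℝ K) (hKc : IsClosed K) (hKfin : μ K ≠ ⊤) (hAK : A ⊆ K)
    {r δ : ℝ} (hd : 1 ≤ Module.finrank ℝ E) (hδ : 0 < δ)
    (hr : (2 * (Module.finrank ℝ E : ℝ) + 1) * δ < r) :
    μ (K ∩ {x | r - δ ≤ Metric.infDist x A ∧ Metric.infDist x A ≤ r + δ}) ≤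
      ENNReal.ofReal ((2 * (Module.finrank ℝ E : ℝ) + 1) * δ / r * (μ K).toReal) := by
  set N := Module.finrank ℝ E
  have hN : (1 : ℝ) ≤ N := by exact_mod_cast hd
  have hNδ : δ ≤ N * δ := le_mul_of_one_le_left hδ.le hN
  have hr0 : 0 < r := by nlinarith
  rcases A.eq_empty_or_nonempty with rfl | hne
  · have : K ∩ {x | r - δ ≤ Metric.infDist x ∅ ∧ Metric.infDist x ∅ ≤ r + δ} = ∅ := by
      ext x
      simp only [Metric.infDist_empty, Set.mem_inter_iff, Set.mem_ofPred_eq,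
        Set.mem_empty_iff_false, iff_false, not_and]
      intro _ h
      linarith
    rw [this]
    simp
  set η : ℝ := (2 * (N : ℝ) + 1) * δ / r / N with hη
  have hNη : N * η = (2 * (N : ℝ) + 1) * δ / r := by
    rw [hη]; field_simp
  have hrη : N * (r * η) = (2 * (N : ℝ) + 1) * δ := by
    rw [hη]; field_simp
  have hη0 : 0 < η := by positivity
  have hη1 : η < 1 := by
    have : (2 * (N : ℝ) + 1) * δ / r < 1 := by rwa [div_lt_one hr0]
    nlinarith
  have hshrink : (1 - η) * (r + δ) < r - δ := by
    have : 2 * δ < r * η := by nlinarith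
    nlinarith [mul_pos hη0 hδ]
  have hpow : 1 - (2 * (N : ℝ) + 1) * δ / r ≤ (1 - η) ^ N := by
    have := one_add_mul_le_pow (a := -η) (by linarith) N
    rw [← hNη]
    calc _ = 1 + N * -η := by ring
      _ ≤ _ := this
      _ = _ := by ring
  have hmain := hK.pow_mul_addHaar_infDist_le μ isClosed_closure hne.closure
    (closure_minimal hAK hKc) (s := r + δ) (sub_pos.2 hη1) (by linarith)
  simp only [Metric.infDist_closure] at hmain
  set S₁ := K ∩ {x | Metric.infDist x A ≤ r + δ}
  set S₂ := K ∩ {x | Metric.infDist x A ≤ (1 - η) * (r + δ)}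
  have hS₁ : μ S₁ ≠ ⊤ := measure_ne_top_of_subset Set.inter_subset_left hKfin
  have hS₂ : μ S₂ ≠ ⊤ := measure_ne_top_of_subset Set.inter_subset_left hKfin
  have hsub : S₂ ⊆ S₁ := fun x hx => ⟨hx.1, by
    have := hx.2
    simp only [Set.mem_ofPred_eq] at this ⊢
    linarith⟩
  have hmeas : MeasurableSet S₂ :=
    (hKc.inter (isClosed_le (Metric.continuous_infDist_pt A) continuous_const)).measurableSet
  have hshell : K ∩ {x | r - δ ≤ Metric.infDist x A ∧ Metric.infDist x A ≤ r + δ} ⊆ S₁ \ S₂ := by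
    rintro x ⟨hxK, hx1, hx2⟩
    refine ⟨⟨hxK, hx2⟩, fun h => ?_⟩
    have := h.2
    simp only [Set.mem_ofPred_eq] at this
    linarith
  refine (measure_mono hshell).trans ?_
  rw [measure_sdiff hsub hmeas.nullMeasurableSet hS₂]
  rw [← ENNReal.ofReal_toReal hS₁, ← ENNReal.ofReal_toReal hS₂] at hmain ⊢
  have hl0 : 0 ≤ (1 - η) ^ N := pow_nonneg (by linarith) _
  rw [← ENNReal.ofReal_mul hl0, ENNReal.ofReal_le_ofReal_iff ENNReal.toReal_nonneg] at hmain
  rw [← ENNReal.ofReal_sub _ ENNReal.toReal_nonneg]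
  apply ENNReal.ofReal_le_ofReal
  have hle : (μ S₁).toReal ≤ (μ K).toReal :=
    ENNReal.toReal_mono hKfin (measure_mono Set.inter_subset_left)
  have hq : 0 ≤ (2 * (N : ℝ) + 1) * δ / r := by positivity
  nlinarith [mul_le_mul_of_nonneg_left hle hq,
    mul_le_mul_of_nonneg_right hpow (ENNReal.toReal_nonneg (a := μ S₁))]

end Expansion

/-- Counting grid points below a level approximates the level up to the mesh. -/
theorem grid_sum_bounds {m h u : ℝ} (hh : 0 ≤ h) (hu : m ≤ u) (n : ℕ) :
    min (u - m) (n * h) ≤ ∑ k ∈ Finset.range n, (if m + k * h < u then h else 0) ∧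
    ∑ k ∈ Finset.range n, (if m + k * h < u then h else 0) ≤ min (u - m + h) (n * h) := by
  induction n with
  | zero =>
    have : 0 ≤ u - m + h := by linarith
    simpa using this
  | succ n ih =>
    rw [Finset.sum_range_succ, le_min_iff]
    rw [min_le_iff, le_min_iff] at ih
    rw [min_le_iff]
    push_cast
    obtain ⟨h1, h2, h3⟩ := ih
    split_ifs with hc
    · refine ⟨?_, ?_, ?_⟩
      · right
        rcases h1 with h1 | h1 <;> linarith
      · linarith
      · linarith
    · refine ⟨?_, ?_, ?_⟩
      · left
        rcases h1 with h1 | h1 <;> linarith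
      · linarith
      · linarith

theorem oscOn_le_of_bounds {E : Type*} [MetricSpace E] {D : Set E} {g : E → ℝ} {ρ a b : ℝ}
    {x : E} (hx : x ∈ D) (hρ : 0 ≤ ρ)
    (h : ∀ y ∈ D, dist y x ≤ ρ → a ≤ g y ∧ g y ≤ b) : oscOn D g ρ x ≤ b - a := by
  have hne : (g '' (D ∩ Metric.closedBall x ρ)).Nonempty :=
    ⟨g x, x, ⟨hx, Metric.mem_closedBall_self hρ⟩, rfl⟩
  refine sub_le_sub (csSup_le hne ?_) (le_csInf hne ?_)
  · rintro _ ⟨y, ⟨hy, hyx⟩, rfl⟩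
    exact (h y hy hyx).2
  · rintro _ ⟨y, ⟨hy, hyx⟩, rfl⟩
    exact (h y hy hyx).1

theorem oscOn_nonneg {E : Type*} [MetricSpace E] {D : Set E} {g : E → ℝ} {ρ m M : ℝ}
    {x : E} (hx : x ∈ D) (hρ : 0 ≤ ρ) (h : ∀ y ∈ D, m ≤ g y ∧ g y ≤ M) : 0 ≤ oscOn D g ρ x := by
  have hx' : g x ∈ g '' (D ∩ Metric.closedBall x ρ) :=
    ⟨x, ⟨hx, Metric.mem_closedBall_self hρ⟩, rfl⟩
  refine sub_nonneg.2 ((csInf_le ⟨m, ?_⟩ hx').trans (le_csSup ⟨M, ?_⟩ hx'))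
  · rintro _ ⟨y, ⟨hy, -⟩, rfl⟩
    exact (h y hy).1
  · rintro _ ⟨y, ⟨hy, -⟩, rfl⟩
    exact (h y hy).2

theorem sSup_image_closedBall_mono {E : Type*} [MetricSpace E] {D : Set E} {f : E → ℝ} {M : ℝ}
    (hf : ∀ x ∈ D, f x ≤ M) {x y : E} {ρ σ : ℝ} (hx : x ∈ D) (hρ : 0 ≤ ρ)
    (h : ρ + dist x y ≤ σ) :
    sSup (f '' (D ∩ Metric.closedBall x ρ)) ≤ sSup (f '' (D ∩ Metric.closedBall y σ)) := by
  refine csSup_le_csSup ⟨M, ?_⟩ ⟨f x, x, ⟨hx, Metric.mem_closedBall_self hρ⟩, rfl⟩ ?_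
  · rintro _ ⟨z, ⟨hz, -⟩, rfl⟩
    exact hf z hz
  · exact Set.image_mono (Set.inter_subset_inter_right _ (Metric.closedBall_subset_closedBall' h))

theorem sInf_image_eq_neg_sSup_neg {E : Type*} (f : E → ℝ) (s : Set E) :
    sInf (f '' s) = -sSup ((-f) '' s) := by
  rw [Real.sInf_def, ← Set.image_neg_eq_neg, Set.image_image]
  rfl

/-- If the local supremum of `f` crosses the level `t` between the radii `ρ` and `σ`, then the
distance to the superlevel set lies between these radii. -/
theorem infDist_superlevel_mem {E : Type*} [MetricSpace E] {D : Set E} {f : E → ℝ} {M : ℝ}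
    (hf : ∀ x ∈ D, f x ≤ M) {x : E} {ρ σ t : ℝ} (hx : x ∈ D) (hσ : 0 ≤ σ)
    (h₁ : sSup (f '' (D ∩ Metric.closedBall x ρ)) ≤ t)
    (h₂ : t < sSup (f '' (D ∩ Metric.closedBall x σ))) :
    ρ ≤ Metric.infDist x {y | y ∈ D ∧ t < f y} ∧
      Metric.infDist x {y | y ∈ D ∧ t < f y} ≤ σ := by
  have hball : (D ∩ Metric.closedBall x σ).Nonempty := ⟨x, hx, Metric.mem_closedBall_self hσ⟩
  obtain ⟨_, ⟨y, ⟨hyD, hyσ⟩, rfl⟩, hy⟩ := exists_lt_of_lt_csSup (hball.image f) h₂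
  have hne : {y | y ∈ D ∧ t < f y}.Nonempty := ⟨y, hyD, hy⟩
  refine ⟨(Metric.le_infDist hne).2 fun z hz => ?_, ?_⟩
  · by_contra! hlt
    have hbdd : BddAbove (f '' (D ∩ Metric.closedBall x ρ)) := by
      refine ⟨M, ?_⟩
      rintro _ ⟨w, ⟨hw, -⟩, rfl⟩
      exact hf w hw
    have hzρ : z ∈ D ∩ Metric.closedBall x ρ := ⟨hz.1, Metric.mem_closedBall'.2 hlt.le⟩
    exact (hz.2.trans_le ((le_csSup hbdd (Set.mem_image_of_mem f hzρ)).trans h₁)).false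
  · exact (Metric.infDist_le_dist_of_mem (s := {y | y ∈ D ∧ t < f y}) ⟨hyD, hy⟩).trans
      (Metric.mem_closedBall'.1 hyσ)

/-- The increment, from radius `r - δ` to radius `r + δ`, of the local supremum of a bounded
function has a measurable majorant with controlled integral. -/
theorem exists_measurable_majorant_sSup_sub {d : ℕ} (hd : 1 ≤ d)
    {D : Set (EuclideanSpace ℝ (Fin d))} (hDfin : volume (convexHull ℝ D) ≠ ⊤)
    {f : EuclideanSpace ℝ (Fin d) → ℝ} {m M : ℝ} (hmM : m ≤ M)
    (hf : ∀ x ∈ D, m ≤ f x ∧ f x ≤ M) {r δ : ℝ} (hδ : 0 < δ)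
    (hr : (2 * (d : ℝ) + 1) * δ < r) (n : ℕ) :
    ∃ Φ : EuclideanSpace ℝ (Fin d) → ENNReal, Measurable Φ ∧
      (∀ x ∈ D, ENNReal.ofReal (sSup (f '' (D ∩ Metric.closedBall x (r + δ))) -
        sSup (f '' (D ∩ Metric.closedBall x (r - δ)))) ≤ Φ x) ∧
      ∫⁻ x in D, Φ x ≤ ENNReal.ofReal ((M - m) * (volume (convexHull ℝ D)).toReal *
        ((2 * (d : ℝ) + 1) * δ / r + 1 / (n + 1))) := by
  have hδr : δ ≤ r - δ := by
    have : (1 : ℝ) ≤ d := by exact_mod_cast hd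
    nlinarith
  have hr0 : 0 < r := by linarith
  set V := (volume (convexHull ℝ D)).toReal
  set K := closure (convexHull ℝ D)
  have hDK : D ⊆ K := (subset_convexHull ℝ D).trans subset_closure
  have hvolK : volume K = volume (convexHull ℝ D) :=
    measure_congr (closure_ae_eq_of_null_frontier ((convex_convexHull ℝ D).addHaar_frontier _))
  have hVK : volume K = ENNReal.ofReal V := by rw [hvolK, ENNReal.ofReal_toReal hDfin]
  set h : ℝ := (M - m) / (n + 1) with hh
  have hh0 : 0 ≤ h := div_nonneg (sub_nonneg.2 hmM) (by positivity)
  have hnh : ((n + 1 : ℕ) : ℝ) * h = M - m := by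
    rw [hh]; push_cast; field_simp
  let A : ℕ → Set (EuclideanSpace ℝ (Fin d)) := fun k => {y | y ∈ D ∧ m + k * h < f y}
  let shell : ℕ → Set (EuclideanSpace ℝ (Fin d)) := fun k =>
    {x | r - δ ≤ Metric.infDist x (A k) ∧ Metric.infDist x (A k) ≤ r + δ}
  have hshell : ∀ k, MeasurableSet (shell k) := fun k =>
    ((isClosed_le continuous_const (Metric.continuous_infDist_pt _)).inter
      (isClosed_le (Metric.continuous_infDist_pt _) continuous_const)).measurableSet
  have hmeas : ∀ k, Measurable ((shell k).indicator fun _ => ENNReal.ofReal h) := fun k =>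
    measurable_const.indicator (hshell k)
  refine ⟨fun x => ∑ k ∈ Finset.range (n + 1), (shell k).indicator (fun _ => ENNReal.ofReal h) x
    + ENNReal.ofReal h, (Finset.measurable_fun_sum _ fun k _ => hmeas k).add_const _, ?_, ?_⟩
  · intro x hx
    set u := sSup (f '' (D ∩ Metric.closedBall x (r - δ))) with hu
    set w := sSup (f '' (D ∩ Metric.closedBall x (r + δ))) with hw
    have hmu : m ≤ u := (hf x hx).1.trans (le_csSup ⟨M, by
      rintro _ ⟨y, ⟨hy, -⟩, rfl⟩
      exact (hf y hy).2⟩ ⟨x, ⟨hx, Metric.mem_closedBall_self (by linarith)⟩, rfl⟩)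
    have huw : u ≤ w := sSup_image_closedBall_mono (fun y hy => (hf y hy).2) hx (by linarith)
      (by rw [dist_self]; linarith)
    have hwM : w ≤ M := csSup_le ⟨f x, x, ⟨hx, Metric.mem_closedBall_self (by linarith)⟩, rfl⟩
      (by rintro _ ⟨y, ⟨hy, -⟩, rfl⟩; exact (hf y hy).2)
    have h1 := (grid_sum_bounds hh0 (hmu.trans huw) (n + 1)).1
    have h2 := (grid_sum_bounds hh0 hmu (n + 1)).2
    rw [hnh, min_eq_left (by linarith)] at h1
    have h3 := h2.trans (min_le_left _ _)
    have hterm : ∀ k : ℕ, (if m + k * h < w then h else 0) ≤ (if m + k * h < u then h else 0) +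
        (shell k).indicator (fun _ => h) x := by
      intro k
      have hind : 0 ≤ (shell k).indicator (fun _ => h) x :=
        Set.indicator_nonneg (fun _ _ => hh0) x
      split_ifs with hkw hku hku
      · linarith
      · have hmem : x ∈ shell k := infDist_superlevel_mem (fun y hy => (hf y hy).2) hx
          (by linarith) (not_lt.1 hku) hkw
        rw [Set.indicator_of_mem hmem]; linarith
      · linarith
      · linarith
    have hsum := Finset.sum_le_sum fun k (_ : k ∈ Finset.range (n + 1)) => hterm k
    rw [Finset.sum_add_distrib] at hsum
    have hind : ∀ k, (shell k).indicator (fun _ => ENNReal.ofReal h) x =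
        ENNReal.ofReal ((shell k).indicator (fun _ => h) x) := by
      intro k
      by_cases hk : x ∈ shell k <;> simp [hk]
    have hnn : ∀ k ∈ Finset.range (n + 1), 0 ≤ (shell k).indicator (fun _ => h) x :=
      fun k _ => Set.indicator_nonneg (fun _ _ => hh0) x
    simp only [hind]
    rw [← ENNReal.ofReal_sum_of_nonneg hnn, ← ENNReal.ofReal_add (Finset.sum_nonneg hnn) hh0]
    apply ENNReal.ofReal_le_ofReal
    linarith
  · refine (lintegral_mono_set hDK).trans ?_
    rw [lintegral_add_right _ measurable_const, lintegral_finsetSum _ fun k _ => hmeas k]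
    set q := (2 * (d : ℝ) + 1) * δ / r with hq
    have hq0 : 0 ≤ q := by positivity
    have hV0 : 0 ≤ V := ENNReal.toReal_nonneg
    have hk : ∀ k, ∫⁻ x in K, (shell k).indicator (fun _ => ENNReal.ofReal h) x ≤
        ENNReal.ofReal (h * (q * V)) := by
      intro k
      rw [lintegral_indicator_const (hshell k), Measure.restrict_apply (hshell k),
        ENNReal.ofReal_mul hh0, Set.inter_comm]
      have := (convex_convexHull ℝ D).closure.addHaar_shell_le volume isClosed_closure
        (hvolK ▸ hDfin) (A := A k) (r := r) (δ := δ) (fun y hy => hDK hy.1) (by simpa using hd) hδ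
        (by simpa using hr)
      rw [finrank_euclideanSpace_fin, hvolK] at this
      exact mul_le_mul_right this _
    refine (add_le_add (Finset.sum_le_sum fun k _ => hk k) le_rfl).trans ?_
    rw [Finset.sum_const, Finset.card_range, setLIntegral_const, hVK, ← ENNReal.ofReal_mul hh0,
      nsmul_eq_mul, ← ENNReal.ofReal_natCast, ← ENNReal.ofReal_mul (Nat.cast_nonneg _),
      ← ENNReal.ofReal_add (by positivity) (by positivity)]
    apply ENNReal.ofReal_le_ofReal
    rw [← mul_assoc, hnh, hh]
    apply le_of_eq
    ring

/-- The oscillation at scale `δ` of `oscOn D f r` is controlled by the increments of the local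
supremum and infimum of `f` between the radii `r - δ` and `r + δ`. -/
theorem oscOn_oscOn_le {E : Type*} [MetricSpace E] {D : Set E} {f : E → ℝ} {m M : ℝ}
    (hf : ∀ x ∈ D, m ≤ f x ∧ f x ≤ M) {x : E} {r δ : ℝ} (hx : x ∈ D) (hδ : 0 ≤ δ) (hr : δ ≤ r) :
    oscOn D (oscOn D f r) δ x ≤
      (sSup (f '' (D ∩ Metric.closedBall x (r + δ))) -
        sSup (f '' (D ∩ Metric.closedBall x (r - δ)))) +
      (sSup ((-f) '' (D ∩ Metric.closedBall x (r + δ))) -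
        sSup ((-f) '' (D ∩ Metric.closedBall x (r - δ)))) := by
  have hf₁ : ∀ y ∈ D, f y ≤ M := fun y hy => (hf y hy).2
  have hf₂ : ∀ y ∈ D, (-f) y ≤ -m := fun y hy => neg_le_neg (hf y hy).1
  have hbound : ∀ y ∈ D, dist y x ≤ δ →
      sSup (f '' (D ∩ Metric.closedBall x (r - δ))) +
        sSup ((-f) '' (D ∩ Metric.closedBall x (r - δ))) ≤ oscOn D f r y ∧
      oscOn D f r y ≤ sSup (f '' (D ∩ Metric.closedBall x (r + δ))) +
        sSup ((-f) '' (D ∩ Metric.closedBall x (r + δ))) := by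
    intro y hy hyx
    rw [oscOn, sInf_image_eq_neg_sSup_neg, sub_neg_eq_add]
    have hxy : r - δ + dist x y ≤ r := by rw [dist_comm]; linarith
    have hr0 : 0 ≤ r := hδ.trans hr
    have hyx' : r + dist y x ≤ r + δ := by linarith
    exact ⟨add_le_add (sSup_image_closedBall_mono hf₁ hx (sub_nonneg.2 hr) hxy)
      (sSup_image_closedBall_mono hf₂ hx (sub_nonneg.2 hr) hxy),
      add_le_add (sSup_image_closedBall_mono hf₁ hy hr0 hyx')
      (sSup_image_closedBall_mono hf₂ hy hr0 hyx')⟩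
  refine (oscOn_le_of_bounds hx hδ hbound).trans (le_of_eq ?_)
  ring

/-- For a bounded function `f` on a measurable set `D ⊆ ℝ^d` whose convex hull
has finite Lebesgue measure, the generalized `α`-Hölder seminorm of the
`r`-oscillation `osc_r f` is at most
`2 * (sup_D f - inf_D f) * Leb(convexHull D) * ((2d+1)/r) ^ α`:
for every `δ > 0`, the outer integral of `osc_δ (osc_r f)` over `D` is at most
this quantity times `δ ^ α`. -/
theorem osc_genHolder_seminorm_bound
    {d : ℕ} (hd : 1 ≤ d)
    (D : Set (EuclideanSpace ℝ (Fin d))) (hD : MeasurableSet D)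
    (hDfin : volume (convexHull ℝ D) ≠ ⊤)
    (f : EuclideanSpace ℝ (Fin d) → ℝ)
    (hfb : ∃ M : ℝ, ∀ x ∈ D, |f x| ≤ M)
    {r α : ℝ} (hr : 0 < r) (hα : 0 < α) (hα1 : α ≤ 1) :
    ∀ δ : ℝ, 0 < δ →
      ∫⁻ x in D, ENNReal.ofReal (oscOn D (oscOn D f r) δ x) ≤
        ENNReal.ofReal
          (2 * (sSup (f '' D) - sInf (f '' D)) * (volume (convexHull ℝ D)).toReal *
            ((2 * (d : ℝ) + 1) / r) ^ α * δ ^ α) := by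
  intro δ hδ
  obtain ⟨B, hB⟩ := hfb
  rcases D.eq_empty_or_nonempty with rfl | ⟨x₀, hx₀⟩
  · simp
  set m := sInf (f '' D)
  set M := sSup (f '' D)
  have hf : ∀ x ∈ D, m ≤ f x ∧ f x ≤ M := fun x hx =>
    ⟨csInf_le ⟨-B, by rintro _ ⟨y, hy, rfl⟩; exact (abs_le.1 (hB y hy)).1⟩ ⟨x, hx, rfl⟩,
      le_csSup ⟨B, by rintro _ ⟨y, hy, rfl⟩; exact (abs_le.1 (hB y hy)).2⟩ ⟨x, hx, rfl⟩⟩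
  have hmM : m ≤ M := (hf x₀ hx₀).1.trans (hf x₀ hx₀).2
  set V := (volume (convexHull ℝ D)).toReal with hV
  have hV0 : 0 ≤ V := ENNReal.toReal_nonneg
  have hSV : 0 ≤ (M - m) * V := mul_nonneg (sub_nonneg.2 hmM) hV0
  set q := (2 * (d : ℝ) + 1) * δ / r with hq
  have hq0 : 0 < q := by positivity
  have hqα : ((2 * (d : ℝ) + 1) / r) ^ α * δ ^ α = q ^ α := by
    rw [← Real.mul_rpow (by positivity) hδ.le, hq]
    congr 1
    ring
  rw [mul_assoc _ (_ ^ α), hqα]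
  rcases lt_or_ge q 1 with hq1 | hq1
  · have hr' : (2 * (d : ℝ) + 1) * δ < r := by rwa [hq, div_lt_one hr] at hq1
    have hδr : δ ≤ r := by nlinarith [mul_nonneg (Nat.cast_nonneg (α := ℝ) d) hδ.le]
    have hbound : ∀ n : ℕ, ∫⁻ x in D, ENNReal.ofReal (oscOn D (oscOn D f r) δ x) ≤
        ENNReal.ofReal (2 * ((M - m) * V * (q + 1 / ((n : ℝ) + 1)))) := by
      intro n
      obtain ⟨Φ, hΦm, hΦ, hΦint⟩ :=
        exists_measurable_majorant_sSup_sub hd hDfin hmM hf hδ hr' n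
      obtain ⟨Ψ, hΨm, hΨ, hΨint⟩ :=
        exists_measurable_majorant_sSup_sub hd hDfin (f := -f) (neg_le_neg hmM)
          (fun x hx => ⟨neg_le_neg (hf x hx).2, neg_le_neg (hf x hx).1⟩) hδ hr' n
      calc ∫⁻ x in D, ENNReal.ofReal (oscOn D (oscOn D f r) δ x)
          ≤ ∫⁻ x in D, (Φ x + Ψ x) := setLIntegral_mono (hΦm.add hΨm) fun x hx =>
            (ENNReal.ofReal_le_ofReal (oscOn_oscOn_le hf hx hδ.le hδr)).trans
              (ENNReal.ofReal_add_le.trans (add_le_add (hΦ x hx) (hΨ x hx)))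
        _ = (∫⁻ x in D, Φ x) + ∫⁻ x in D, Ψ x := lintegral_add_left hΦm _
        _ ≤ ENNReal.ofReal ((M - m) * V * (q + 1 / ((n : ℝ) + 1))) +
            ENNReal.ofReal ((-m - -M) * V * (q + 1 / ((n : ℝ) + 1))) := add_le_add hΦint hΨint
        _ = _ := by
          rw [neg_sub_neg, ← ENNReal.ofReal_add (by positivity) (by positivity)]
          congr 1
          ring
    have hlim : Filter.Tendsto
        (fun n : ℕ => ENNReal.ofReal (2 * ((M - m) * V * (q + 1 / ((n : ℝ) + 1)))))
        Filter.atTop (nhds (ENNReal.ofReal (2 * ((M - m) * V * (q + 0))))) :=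
      ENNReal.tendsto_ofReal (((tendsto_one_div_add_atTop_nhds_zero_nat.const_add q).const_mul
        ((M - m) * V)).const_mul 2)
    refine (ge_of_tendsto' hlim hbound).trans (ENNReal.ofReal_le_ofReal ?_)
    have hle : q ≤ q ^ α := by
      simpa using Real.rpow_le_rpow_of_exponent_ge hq0 hq1.le hα1
    nlinarith [mul_le_mul_of_nonneg_left hle hSV]
  · have hosc : ∀ x ∈ D, oscOn D (oscOn D f r) δ x ≤ M - m := fun x hx => by
      simpa using oscOn_le_of_bounds (a := 0) (b := M - m) hx hδ.le fun y hy _ =>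
        ⟨oscOn_nonneg hy hr.le hf, oscOn_le_of_bounds hy hr.le fun z hz _ => hf z hz⟩
    calc ∫⁻ x in D, ENNReal.ofReal (oscOn D (oscOn D f r) δ x)
        ≤ ∫⁻ x in D, ENNReal.ofReal (M - m) := setLIntegral_mono measurable_const fun x hx =>
          ENNReal.ofReal_le_ofReal (hosc x hx)
      _ = ENNReal.ofReal (M - m) * volume D := setLIntegral_const _ _
      _ ≤ ENNReal.ofReal (M - m) * volume (convexHull ℝ D) :=
        mul_le_mul_right (measure_mono (subset_convexHull ℝ D)) _
      _ = ENNReal.ofReal ((M - m) * V) := by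
        rw [ENNReal.ofReal_mul (sub_nonneg.2 hmM), hV, ENNReal.ofReal_toReal hDfin]
      _ ≤ _ := by
        apply ENNReal.ofReal_le_ofReal
        have h1 : 1 ≤ q ^ α := Real.one_le_rpow hq1 hα.le
        nlinarith [mul_le_mul_of_nonneg_left h1 hSV]
end

section
/- For all x, y ∈ ℝ³ and all r > 0, the Lebesgue measure of the set difference of the two closed balls of radius r centred at y and at x satisfies Leb(B_r(y) \ B_r(x)) ≤ π·r²·‖y − x‖. -/
open MeasureTheory Real

/-- The difference of two balls of radius `r` in `ℝ × ℝ²`, centred at `(d, 0)` and at `0`. -/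
def prodBallDiff (r d : ℝ) : Set (ℝ × (Fin 2 → ℝ)) :=
  {p | (p.1 - d) ^ 2 + (p.2 0 ^ 2 + p.2 1 ^ 2) ≤ r ^ 2 ∧
    r ^ 2 < p.1 ^ 2 + (p.2 0 ^ 2 + p.2 1 ^ 2)}

theorem measurableSet_prodBallDiff (r d : ℝ) : MeasurableSet (prodBallDiff r d) := by
  rw [prodBallDiff, Set.ofPred_and]
  exact (measurableSet_le (by fun_prop) (by fun_prop)).inter
    (measurableSet_lt (by fun_prop) (by fun_prop))

/-- Each line parallel to the first axis meets `prodBallDiff r d` in a set of length at most `d`,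
and only the lines over a disc of radius `r` meet it. -/
theorem volume_prodBallDiff_le {r d : ℝ} (hr : 0 ≤ r) (hd : 0 ≤ d) :
    volume (prodBallDiff r d) ≤ ENNReal.ofReal (π * r ^ 2 * d) := by
  have hdisc : volume {w : Fin 2 → ℝ | w 0 ^ 2 + w 1 ^ 2 ≤ r ^ 2} =
      ENNReal.ofReal (π * r ^ 2) := by
    have hpre : {w : Fin 2 → ℝ | w 0 ^ 2 + w 1 ^ 2 ≤ r ^ 2} =
        WithLp.toLp 2 ⁻¹' Metric.closedBall (0 : EuclideanSpace ℝ (Fin 2)) r := by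
      ext w
      simp [EuclideanSpace.norm_eq, Fin.sum_univ_two, Real.sqrt_le_left hr]
    rw [hpre, (PiLp.volume_preserving_toLp (Fin 2)).measure_preimage
      Metric.isClosed_closedBall.measurableSet.nullMeasurableSet,
      EuclideanSpace.volume_closedBall_fin_two, mul_comm π, ENNReal.ofReal_mul (by positivity),
      ENNReal.ofReal_pow hr, ← NNReal.coe_real_pi, ENNReal.ofReal_coe_nnreal]
  have hmeas : MeasurableSet {w : Fin 2 → ℝ | w 0 ^ 2 + w 1 ^ 2 ≤ r ^ 2} :=
    measurableSet_le (by fun_prop) (by fun_prop)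
  rw [Measure.volume_eq_prod, Measure.prod_apply_symm (measurableSet_prodBallDiff r d)]
  calc
    _ ≤ ∫⁻ w, {w : Fin 2 → ℝ | w 0 ^ 2 + w 1 ^ 2 ≤ r ^ 2}.indicator
          (fun _ => ENNReal.ofReal d) w := by
      refine lintegral_mono fun w => ?_
      by_cases hw : w 0 ^ 2 + w 1 ^ 2 ≤ r ^ 2
      · rw [Set.indicator_of_mem (by exact hw)]
        set s := √(r ^ 2 - (w 0 ^ 2 + w 1 ^ 2))
        have hs_nonneg : 0 ≤ s := Real.sqrt_nonneg _
        have hs_sq : s ^ 2 = r ^ 2 - (w 0 ^ 2 + w 1 ^ 2) := Real.sq_sqrt (by linarith)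
        refine (measure_mono (t := Set.Icc s (s + d)) ?_).trans (by simp)
        rintro t ⟨h₁, h₂⟩
        dsimp only at h₁ h₂
        obtain ⟨hl, hu⟩ := abs_le_of_sq_le_sq' (show (t - d) ^ 2 ≤ s ^ 2 by linarith) hs_nonneg
        exact ⟨by nlinarith, by linarith⟩
      · refine (measure_mono (t := ∅) ?_).trans (by simp)
        rintro t ⟨h₁, -⟩
        dsimp only at h₁
        exact hw (by nlinarith [sq_nonneg (t - d)])
    _ = ENNReal.ofReal (π * r ^ 2 * d) := by
      rw [lintegral_indicator_const hmeas, hdisc, mul_comm, ← ENNReal.ofReal_mul (by positivity)]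

/-- Every vector is a nonnegative multiple of the first vector of some orthonormal basis. -/
theorem exists_orthonormalBasis_eq_norm_smul {n : ℕ} (v : EuclideanSpace ℝ (Fin (n + 1))) :
    ∃ b : OrthonormalBasis (Fin (n + 1)) ℝ (EuclideanSpace ℝ (Fin (n + 1))),
      v = ‖v‖ • b 0 := by
  rcases eq_or_ne v 0 with rfl | hv
  · exact ⟨EuclideanSpace.basisFun _ ℝ, by simp⟩
  · have horth : Orthonormal ℝ
        (({0} : Set (Fin (n + 1))).domRestrict fun _ => ‖v‖⁻¹ • v) := by
      refine ⟨fun _ => by simp [Set.domRestrict, norm_smul, hv], fun i j hij => ?_⟩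
      exact absurd (Subsingleton.elim i j) hij
    obtain ⟨b, hb⟩ := horth.exists_orthonormalBasis_extension_of_card_eq (by simp)
    refine ⟨b, ?_⟩
    rw [hb 0 rfl, smul_smul, mul_inv_cancel₀ (norm_ne_zero_iff.mpr hv), one_smul]

/-- The Lebesgue measure of the difference of two closed balls of radius `r`
in `ℝ³` centred at `y` and `x` is at most `π r² ‖y - x‖`. -/
theorem volume_ball_diff_le
    (x y : EuclideanSpace ℝ (Fin 3)) {r : ℝ} (hr : 0 < r) :
    volume (Metric.closedBall y r \ Metric.closedBall x r) ≤
      ENNReal.ofReal (π * r ^ 2 * ‖y - x‖) := by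
  obtain ⟨b, hb⟩ := exists_orthonormalBasis_eq_norm_smul (y - x)
  have hφ := (volume_preserving_piFinSuccAbove (fun _ : Fin 3 => ℝ) 0).comp
    ((PiLp.volume_preserving_ofLp (Fin 3)).comp
      (b.measurePreserving_repr.comp (measurePreserving_sub_right volume x)))
  refine le_trans ?_ (volume_prodBallDiff_le hr.le (norm_nonneg (y - x)))
  rw [← hφ.measure_preimage (measurableSet_prodBallDiff r _).nullMeasurableSet]
  refine measure_mono ?_
  rintro z ⟨hy, hx⟩
  have hnorm (v : EuclideanSpace ℝ (Fin 3)) :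
      ‖v‖ ^ 2 = b.repr v 0 ^ 2 + (b.repr v 1 ^ 2 + b.repr v 2 ^ 2) := by
    rw [← b.repr.norm_map v, EuclideanSpace.real_norm_sq_eq, Fin.sum_univ_three, add_assoc]
  have hzy : b.repr (z - y) = b.repr (z - x) - ‖y - x‖ • EuclideanSpace.single 0 1 := by
    rw [← b.repr_self, ← map_smul, ← hb, ← map_sub, sub_sub_sub_cancel_right]
  rw [mem_closedBall_iff_norm, ← sq_le_sq₀ (norm_nonneg _) hr.le, hnorm, hzy] at hy
  rw [mem_closedBall_iff_norm, not_le, ← sq_lt_sq₀ hr.le (norm_nonneg _), hnorm] at hx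
  exact ⟨by simpa [Fin.tail] using hy, hx⟩
end

section
/- Let Γ > 0, 0 < L ≤ 1/(100Γ), let γ : [0,L] → ℝ³ be a twice continuously differentiable unit-speed curve with ‖γ''(s)‖ ≤ Γ for all s, and suppose γ'(s₀) = e for some s₀ ∈ [0,L] and some unit vector e. Let z₁, z₂ ∈ ℝ³ satisfy ⟨z₁, e⟩ = ⟨z₂, e⟩ = 0. Then for all s₁, s₂ ∈ [0,L], ‖(γ(s₁) + z₁) − (γ(s₂) + z₂)‖ ≥ (1/2)·‖z₁ − z₂‖; in particular the distance between the translated curves γ + z₁ and γ + z₂ is at least (1/2)·‖z₁ − z₂‖. -/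
open scoped RealInnerProductSpace

/-- Adding a multiple `t • e` of a unit vector orthogonal to `w`, and then an error of size at most
`c * |t|`, shrinks the norm of `w` by a factor of at worst `1 - c`. -/
lemma one_sub_mul_norm_le_norm_add_smul_add {E : Type*} [NormedAddCommGroup E]
    [InnerProductSpace ℝ E] {w e r : E} {t c : ℝ} (he : ‖e‖ = 1) (hw : ⟪w, e⟫ = 0)
    (hc₀ : 0 ≤ c) (hc₁ : c ≤ 1) (hr : ‖r‖ ≤ c * |t|) :
    (1 - c) * ‖w‖ ≤ ‖w + t • e + r‖ := by
  have hpyth : ‖w + t • e‖ * ‖w + t • e‖ = ‖w‖ * ‖w‖ + |t| * |t| := by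
    rw [norm_add_sq_eq_norm_sq_add_norm_sq_real (by rw [inner_smul_right, hw, mul_zero]),
      norm_smul, he, mul_one, Real.norm_eq_abs]
  have hwle : ‖w‖ ≤ ‖w + t • e‖ := by
    nlinarith [norm_nonneg w, norm_nonneg (w + t • e), abs_nonneg t]
  have htle : |t| ≤ ‖w + t • e‖ := by
    nlinarith [norm_nonneg w, norm_nonneg (w + t • e), abs_nonneg t]
  have htri : ‖w + t • e‖ - ‖r‖ ≤ ‖w + t • e + r‖ := norm_sub_le_norm_add _ _
  nlinarith [mul_le_mul_of_nonneg_left hwle (sub_nonneg.2 hc₁),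
    mul_le_mul_of_nonneg_left htle hc₀]

/-- If `γ` is a `C²` unit-speed curve of curvature at most `Γ` and length
`L ≤ 1/(100Γ)`, whose tangent equals the unit vector `e` at some parameter,
and `z₁, z₂` are orthogonal to `e`, then the distance between any point of
`γ + z₁` and any point of `γ + z₂` is at least `‖z₁ - z₂‖ / 2`. -/
theorem translated_curves_not_close
    {Γ L : ℝ} (hΓ : 0 < Γ) (hL : 0 < L) (hLΓ : L ≤ 1 / (100 * Γ))
    (γ γ' γ'' : ℝ → EuclideanSpace ℝ (Fin 3))
    (hderiv : ∀ s ∈ Set.Icc (0 : ℝ) L, HasDerivAt γ (γ' s) s)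
    (hderiv' : ∀ s ∈ Set.Icc (0 : ℝ) L, HasDerivAt γ' (γ'' s) s)
    (hcont : ContinuousOn γ'' (Set.Icc (0 : ℝ) L))
    (hunit : ∀ s ∈ Set.Icc (0 : ℝ) L, ‖γ' s‖ = 1)
    (hcurv : ∀ s ∈ Set.Icc (0 : ℝ) L, ‖γ'' s‖ ≤ Γ)
    (s₀ : ℝ) (hs₀ : s₀ ∈ Set.Icc (0 : ℝ) L)
    (e : EuclideanSpace ℝ (Fin 3)) (he : ‖e‖ = 1) (htan : γ' s₀ = e)
    (z₁ z₂ : EuclideanSpace ℝ (Fin 3))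
    (hz₁ : ⟪z₁, e⟫ = 0) (hz₂ : ⟪z₂, e⟫ = 0) :
    ∀ s₁ ∈ Set.Icc (0 : ℝ) L, ∀ s₂ ∈ Set.Icc (0 : ℝ) L,
      (1 : ℝ) / 2 * ‖z₁ - z₂‖ ≤ ‖(γ s₁ + z₁) - (γ s₂ + z₂)‖ := by
  intro s₁ hs₁ s₂ hs₂
  have hΓL : Γ * L ≤ 1 / 100 := by
    rw [le_div_iff₀ (by positivity)] at hLΓ
    linarith
  have htangent : ∀ s ∈ Set.Icc (0 : ℝ) L, ‖γ' s - e‖ ≤ 1 / 100 := by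
    intro s hs
    have h := (convex_Icc (0 : ℝ) L).norm_image_sub_le_of_norm_hasDerivWithin_le
      (fun x hx => (hderiv' x hx).hasDerivWithinAt) hcurv hs₀ hs
    rw [htan, Real.norm_eq_abs] at h
    have hdist : |s - s₀| ≤ L := abs_le.2 ⟨by linarith [hs.1, hs₀.2], by linarith [hs.2, hs₀.1]⟩
    exact h.trans ((mul_le_mul_of_nonneg_left hdist hΓ.le).trans hΓL)
  have hchord : ‖γ s₁ - s₁ • e - (γ s₂ - s₂ • e)‖ ≤ 1 / 100 * |s₁ - s₂| := by
    refine (convex_Icc (0 : ℝ) L).norm_image_sub_le_of_norm_hasDerivWithin_le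
      (f := fun s => γ s - s • e) (fun x hx => ?_) htangent hs₂ hs₁
    simpa using ((hderiv x hx).fun_sub ((hasDerivAt_id x).smul_const e)).hasDerivWithinAt
  have hw : ⟪z₁ - z₂, e⟫ = 0 := by rw [inner_sub_left, hz₁, hz₂, sub_zero]
  have hmain := one_sub_mul_norm_le_norm_add_smul_add he hw (by norm_num) (by norm_num) hchord
  have hsum : γ s₁ + z₁ - (γ s₂ + z₂) =
      z₁ - z₂ + (s₁ - s₂) • e + (γ s₁ - s₁ • e - (γ s₂ - s₂ • e)) := by
    module
  rw [hsum]
  linarith [norm_nonneg (z₁ - z₂)]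
end
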